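/- arXiv:math/0503396 — 2 statements merged into one kernel-verified Lean document; each statement's English description precedes it below -/
import Mathlib

section
/- Let M, N ∈ ℕ and take m = M, n = N in the sl(3) realization on ℂ[x,y,z] with raising operators T₁₂ = −x²∂ₓ − xy∂_y + xz∂_z + y∂_z + Nx, T₂₃ = −z²∂_z − y∂ₓ + Mz, T₁₃ = −y²∂_y − xy∂ₓ − z(y+xz)∂_z + (M+N)y + Mxz. Then for all i, j, k ∈ ℕ, T₁₂ⁱ T₂₃ʲ T₁₃ᵏ (1) equals i!·j!·k! times the coefficient of μⁱνʲλᵏ in the polynomial (1 + μx + λy)^N · (1 + νz + (λ+μν)(y+xz))^M ∈ ℂ[x,y,z][μ,ν,λ]; i.e., the generating function of the module basis is e^{μT₁₂} e^{νT₂₃} e^{λT₁₃}·1 = (1+μx+λy)^N (1+νz+(λ+μν)(y+xz))^M. -/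
open MvPolynomial

/-- `ℂ[x,y,z]` with `x = X 0`, `y = X 1`, `z = X 2`. -/
abbrev P3 : Type := MvPolynomial (Fin 3) ℂ

/-- `ℂ[x,y,z][μ,ν,λ]` with `μ = X 0`, `ν = X 1`, `λ = X 2` as outer variables. -/
abbrev Q3 : Type := MvPolynomial (Fin 3) P3

/-- Multiplication operators `x, y, z` on `ℂ[x,y,z]`. -/
noncomputable def Zm (i : Fin 3) : Module.End ℂ P3 := LinearMap.mulLeft ℂ (X i)

/-- Partial derivatives `∂ₓ, ∂_y, ∂_z` on `ℂ[x,y,z]`. -/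
noncomputable def Dm (i : Fin 3) : Module.End ℂ P3 := (pderiv i).toLinearMap

/-- `T₁₂ = −x²∂ₓ − xy∂_y + xz∂_z + y∂_z + Nx`. -/
noncomputable def T12 (N : ℕ) : Module.End ℂ P3 :=
  -(Zm 0 * Zm 0 * Dm 0) - Zm 0 * Zm 1 * Dm 1 + Zm 0 * Zm 2 * Dm 2 + Zm 1 * Dm 2
    + (N : ℂ) • Zm 0

/-- `T₂₃ = −z²∂_z − y∂ₓ + Mz`. -/
noncomputable def T23 (M : ℕ) : Module.End ℂ P3 :=
  -(Zm 2 * Zm 2 * Dm 2) - Zm 1 * Dm 0 + (M : ℂ) • Zm 2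

/-- `T₁₃ = −y²∂_y − xy∂ₓ − z(y+xz)∂_z + (M+N)y + Mxz`. -/
noncomputable def T13 (M N : ℕ) : Module.End ℂ P3 :=
  -(Zm 1 * Zm 1 * Dm 1) - Zm 0 * Zm 1 * Dm 0 - Zm 2 * (Zm 1 + Zm 0 * Zm 2) * Dm 2
    + ((M : ℂ) + (N : ℂ)) • Zm 1 + (M : ℂ) • (Zm 0 * Zm 2)

/-- The generating function `(1 + μx + λy)^N (1 + νz + (λ+μν)(y+xz))^M`. -/
noncomputable def GenF (M N : ℕ) : Q3 :=
  (1 + X 0 * C (X 0 : P3) + X 2 * C (X 1 : P3)) ^ N *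
  (1 + X 1 * C (X 2 : P3) + (X 2 + X 0 * X 1) * C ((X 1 : P3) + (X 0 : P3) * (X 2 : P3))) ^ M

namespace Derivation

variable {σ R A : Type*} [CommRing R] [CommRing A] [Algebra R A]

/-- The derivation of `A[σ]` that applies a derivation of `A` to every coefficient. -/
noncomputable def mvMapCoeffs (D : Derivation R A A) :
    Derivation R (MvPolynomial σ A) (MvPolynomial σ A) :=
  Derivation.mk'
    { toFun := fun p => (⟨Finsupp.mapRange D (map_zero D) (AddMonoidAlgebra.coeff p)⟩ : AddMonoidAlgebra A (σ →₀ ℕ))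
      map_add' := fun p q => MvPolynomial.ext _ _ fun m => D.map_add (coeff m p) (coeff m q)
      map_smul' := fun r p => MvPolynomial.ext _ _ fun m => D.map_smul r (coeff m p) }
    fun p q => MvPolynomial.ext _ _ fun m => by
      classical
      rw [coeff_add, smul_eq_mul, smul_eq_mul, mul_comm q, coeff_mul, coeff_mul,
        ← Finset.sum_add_distrib]
      change D (coeff m (p * q)) = _
      rw [coeff_mul, map_sum]
      refine Finset.sum_congr rfl fun s _ => ?_
      rw [D.leibniz, smul_eq_mul, smul_eq_mul, mul_comm (coeff s.2 q)]
      rfl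

@[simp]
theorem coeff_mvMapCoeffs (D : Derivation R A A) (p : MvPolynomial σ A) (m : σ →₀ ℕ) :
    coeff m (D.mvMapCoeffs p) = D (coeff m p) := rfl

@[simp]
theorem mvMapCoeffs_C (D : Derivation R A A) (a : A) :
    D.mvMapCoeffs (C a : MvPolynomial σ A) = C (D a) := by
  classical
  ext1 m
  simp only [coeff_mvMapCoeffs, coeff_C]
  split_ifs <;> simp

@[simp]
theorem mvMapCoeffs_X (D : Derivation R A A) (i : σ) :
    D.mvMapCoeffs (X i : MvPolynomial σ A) = 0 := by
  classical
  ext1 m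
  simp only [coeff_mvMapCoeffs, coeff_X, coeff_zero]
  split_ifs <;> simp

/-- A product of powers of eigenvectors of a derivation is an eigenvector. -/
theorem map_pow_mul_pow_of_eigenvectors (δ : Derivation R A A) {f g a b : A}
    (hf : δ f = a * f) (hg : δ g = b * g) (N M : ℕ) :
    δ (f ^ N * g ^ M) = (N * a + M * b) * (f ^ N * g ^ M) := by
  have hpow (h c : A) (hh : δ h = c * h) (n : ℕ) : δ (h ^ n) = n * c * h ^ n := by
    rw [leibniz_pow, hh]
    cases n with
    | zero => simp
    | succ n => simp [nsmul_eq_mul]; ring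
  rw [leibniz, hpow f a hf, hpow g b hg, smul_eq_mul, smul_eq_mul]
  ring

end Derivation

/-- If `∂ᵢF = (D + a)F` coefficientwise, then `D + a` raises the `i`-th exponent of the
coefficients of `F`. -/
theorem MvPolynomial.apply_coeff_of_pderiv_sub_mvMapCoeffs {σ R A : Type*} [CommRing R]
    [CommRing A] [Algebra R A] (D : Derivation R A A) (a : A) (i : σ) (F : MvPolynomial σ A)
    (h : ((pderiv i).restrictScalars R - D.mvMapCoeffs :
      Derivation R (MvPolynomial σ A) (MvPolynomial σ A)) F = C a * F) (m : σ →₀ ℕ) :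
    D (coeff m F) + a * coeff m F = (m i + 1) * coeff (m + Finsupp.single i 1) F := by
  have h' := congrArg (coeff m) h
  rw [Derivation.sub_apply, coeff_sub, Derivation.coeff_mvMapCoeffs, coeff_C_mul,
    Derivation.restrictScalars_apply, coeff_pderiv] at h'
  linear_combination -h'

/-- Polynomials congruent modulo a variable have the same coefficients at the monomials not
involving it. -/
theorem MvPolynomial.coeff_eq_of_X_dvd_sub {σ A : Type*} [CommRing A] {i : σ}
    {p q : MvPolynomial σ A} (h : X i ∣ p - q) {m : σ →₀ ℕ} (hm : m i = 0) :
    coeff m p = coeff m q := by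
  classical
  obtain ⟨r, hr⟩ := h
  rw [← sub_eq_zero, ← coeff_sub, hr, coeff_X_mul', if_neg (by simpa using hm)]

/-- Iterating an operator that sends `c n` to `(n + 1) c (n + 1)`. -/
theorem Module.End.pow_apply_eq_factorial_smul {K V : Type*} [Field K] [AddCommGroup V]
    [Module K V] (T : Module.End K V) (c : ℕ → V)
    (h : ∀ n, T (c n) = ((n : K) + 1) • c (n + 1)) (n : ℕ) :
    (T ^ n) (c 0) = (n.factorial : K) • c n := by
  induction n with
  | zero => simp
  | succ n ih =>
    rw [pow_succ', Module.End.mul_apply, ih, map_smul, h, smul_smul, Nat.factorial_succ]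
    push_cast
    rw [mul_comm]

/-- The generating function evaluated at arbitrary parameters `(μ, ν, λ) = (a, b, c)`. -/
noncomputable def genAt (M N : ℕ) (a b c : Q3) : Q3 :=
  (1 + a * C (X 0 : P3) + c * C (X 1 : P3)) ^ N *
  (1 + b * C (X 2 : P3) + (c + a * b) * C ((X 1 : P3) + (X 0 : P3) * (X 2 : P3))) ^ M

theorem dvd_genAt_sub (M N : ℕ) (d a b c a' b' : Q3) (ha : d ∣ a - a') (hb : d ∣ b - b') :
    d ∣ genAt M N a b c - genAt M N a' b' c := by
  rw [← Ideal.mem_span_singleton, ← Ideal.Quotient.eq] at *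
  simp only [genAt, map_mul, map_pow, map_add, ha, hb]

/-- The vector field part of `T12`. -/
noncomputable def V12 : Derivation ℂ P3 P3 :=
  -((X 0 * X 0 : P3) • pderiv 0) - (X 0 * X 1 : P3) • pderiv 1
    + (X 0 * X 2 + X 1 : P3) • pderiv 2

/-- The vector field part of `T23`. -/
noncomputable def V23 : Derivation ℂ P3 P3 :=
  -((X 2 * X 2 : P3) • pderiv 2) - (X 1 : P3) • pderiv 0

/-- The vector field part of `T13`. -/
noncomputable def V13 : Derivation ℂ P3 P3 :=
  -((X 1 * X 1 : P3) • pderiv 1) - (X 0 * X 1 : P3) • pderiv 0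
    - (X 2 * (X 1 + X 0 * X 2) : P3) • pderiv 2

theorem T12_apply (N : ℕ) (f : P3) : T12 N f = V12 f + ((N : P3) * X 0) * f := by
  simp [T12, V12, Zm, Dm, smul_eq_C_mul]
  ring

theorem T23_apply (M : ℕ) (f : P3) : T23 M f = V23 f + ((M : P3) * X 2) * f := by
  simp [T23, V23, Zm, Dm, smul_eq_C_mul]
  ring

theorem T13_apply (M N : ℕ) (f : P3) :
    T13 M N f = V13 f + ((N : P3) * X 1 + (M : P3) * (X 1 + X 0 * X 2)) * f := by
  simp [T13, V13, Zm, Dm, smul_eq_C_mul]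
  ring

theorem T12_coeff_genAt (M N : ℕ) (m : Fin 3 →₀ ℕ) :
    T12 N (coeff m (genAt M N (X 0) (X 1) (X 2)))
      = ((m 0 : ℂ) + 1) • coeff (m + Finsupp.single 0 1) (genAt M N (X 0) (X 1) (X 2)) := by
  rw [T12_apply, MvPolynomial.apply_coeff_of_pderiv_sub_mvMapCoeffs V12 _ 0]
  · simp [smul_eq_C_mul]
  · rw [genAt, Derivation.map_pow_mul_pow_of_eigenvectors _ (a := (C (X 0) : Q3)) (b := 0)]
    · simp
    · simp [V12, pderiv_X]; ring
    · simp [V12, pderiv_X]; ring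

theorem T23_coeff_genAt (M N : ℕ) (m : Fin 3 →₀ ℕ) :
    T23 M (coeff m (genAt M N 0 (X 1) (X 2)))
      = ((m 1 : ℂ) + 1) • coeff (m + Finsupp.single 1 1) (genAt M N 0 (X 1) (X 2)) := by
  rw [T23_apply, MvPolynomial.apply_coeff_of_pderiv_sub_mvMapCoeffs V23 _ 1]
  · simp [smul_eq_C_mul]
  · rw [genAt, Derivation.map_pow_mul_pow_of_eigenvectors _ (a := 0) (b := (C (X 2) : Q3))]
    · simp
    · simp [V23, pderiv_X]
    · simp [V23, pderiv_X]; ring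

theorem T13_coeff_genAt (M N : ℕ) (m : Fin 3 →₀ ℕ) :
    T13 M N (coeff m (genAt M N 0 0 (X 2)))
      = ((m 2 : ℂ) + 1) • coeff (m + Finsupp.single 2 1) (genAt M N 0 0 (X 2)) := by
  rw [T13_apply, MvPolynomial.apply_coeff_of_pderiv_sub_mvMapCoeffs V13 _ 2]
  · simp [smul_eq_C_mul]
  · rw [genAt, Derivation.map_pow_mul_pow_of_eigenvectors _ (a := (C (X 1) : Q3))
      (b := C (X 1 + X 0 * X 2))]
    · simp
    · simp [V13, pderiv_X]; ring
    · simp [V13, pderiv_X]; ring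

theorem T13_pow_one (M N k : ℕ) :
    (T13 M N ^ k) (1 : P3)
      = (k.factorial : ℂ) • coeff (Finsupp.single 2 k) (genAt M N 0 0 (X 2)) := by
  rw [← Module.End.pow_apply_eq_factorial_smul (T13 M N)
    fun n => coeff (Finsupp.single 2 n) (genAt M N 0 0 (X 2))]
  · simp [genAt, ← constantCoeff_eq]
  · intro n
    simp [T13_coeff_genAt, Finsupp.single_add]

theorem T23_pow_coeff (M N j k : ℕ) :
    (T23 M ^ j) (coeff (Finsupp.single 2 k) (genAt M N 0 0 (X 2)))
      = (j.factorial : ℂ) •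
        coeff (Finsupp.single 1 j + Finsupp.single 2 k) (genAt M N 0 (X 1) (X 2)) := by
  rw [← Module.End.pow_apply_eq_factorial_smul (T23 M)
    fun n => coeff (Finsupp.single 1 n + Finsupp.single 2 k) (genAt M N 0 (X 1) (X 2))]
  · have h := MvPolynomial.coeff_eq_of_X_dvd_sub
      (dvd_genAt_sub M N (X 1) 0 (X 1) (X 2) 0 0 (by simp) (by simp))
      (m := Finsupp.single 2 k) (by simp)
    simp [h]
  · intro n
    simp [T23_coeff_genAt, Finsupp.single_add, add_right_comm]

theorem T12_pow_coeff (M N i j k : ℕ) :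
    (T12 N ^ i) (coeff (Finsupp.single 1 j + Finsupp.single 2 k) (genAt M N 0 (X 1) (X 2)))
      = (i.factorial : ℂ) • coeff (Finsupp.single 0 i + Finsupp.single 1 j + Finsupp.single 2 k)
        (genAt M N (X 0) (X 1) (X 2)) := by
  rw [← Module.End.pow_apply_eq_factorial_smul (T12 N)
    fun n => coeff (Finsupp.single 0 n + Finsupp.single 1 j + Finsupp.single 2 k)
      (genAt M N (X 0) (X 1) (X 2))]
  · have h := MvPolynomial.coeff_eq_of_X_dvd_sub
      (dvd_genAt_sub M N (X 0) (X 0) (X 1) (X 2) 0 (X 1) (by simp) (by simp))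
      (m := Finsupp.single 1 j + Finsupp.single 2 k) (by simp)
    simp [h]
  · intro n
    simp [T12_coeff_genAt, Finsupp.single_add, add_right_comm]

/-- The generating function of the `sl(3)` module basis:
`T₁₂ⁱ T₂₃ʲ T₁₃ᵏ (1)` equals `i!·j!·k!` times the coefficient of `μⁱνʲλᵏ` in
`(1 + μx + λy)^N (1 + νz + (λ+μν)(y+xz))^M`, i.e.
`e^{μT₁₂} e^{νT₂₃} e^{λT₁₃}·1 = (1+μx+λy)^N (1+νz+(λ+μν)(y+xz))^M`. -/
theorem sl3_generating_function (M N : ℕ) (i j k : ℕ) :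
    (T12 N ^ i * T23 M ^ j * T13 M N ^ k) (1 : P3)
      = ((i.factorial * j.factorial * k.factorial : ℕ) : ℂ)
          • MvPolynomial.coeff
              (Finsupp.single (0 : Fin 3) i + Finsupp.single 1 j + Finsupp.single 2 k)
              (GenF M N) := by
  rw [Module.End.mul_apply, Module.End.mul_apply, T13_pow_one, map_smul, T23_pow_coeff, map_smul,
    map_smul, T12_pow_coeff, smul_smul, smul_smul, GenF, genAt]
  congr 1
  push_cast
  ring
end

section
/- Let M, N ∈ ℕ and take m = M, n = N in the sl(3) realization on ℂ[x,y,z] (generators T_{ab} as first-order differential operators: T₂₁ = ∂ₓ, T₃₁ = ∂_y, T₃₂ = ∂_z − x∂_y, T₁₂ = −x²∂ₓ − xy∂_y + xz∂_z + y∂_z + Nx, T₂₃ = −z²∂_z − y∂ₓ + Mz, T₁₃ = −y²∂_y − xy∂ₓ − z(y+xz)∂_z + (M+N)y + Mxz, H₁ = 2x∂ₓ + y∂_y − z∂_z − N, H₂ = 2z∂_z + y∂_y − x∂ₓ − M). Then the ℂ-linear span V_{M,N} of {T₁₂ⁱ T₂₃ʲ T₁₃ᵏ (1) : i,j,k ∈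 ℕ} is a finite-dimensional subspace of ℂ[x,y,z] invariant under all of the operators T₂₁, T₃₁, T₃₂, T₁₂, T₂₃, T₁₃, H₁, H₂, and its dimension equals (M+1)(N+1)(M+N+2)/2. -/
open MvPolynomial

/-- `T₂₁ = ∂ₓ`. -/
noncomputable def T21 : Module.End ℂ P3 := Dm 0

/-- `T₃₁ = ∂_y`. -/
noncomputable def T31 : Module.End ℂ P3 := Dm 1

/-- `T₃₂ = ∂_z − x∂_y`. -/
noncomputable def T32 : Module.End ℂ P3 := Dm 2 - Zm 0 * Dm 1

/-- `H₁ = 2x∂ₓ + y∂_y − z∂_z − N`. -/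
noncomputable def H1 (N : ℕ) : Module.End ℂ P3 :=
  (2 : ℂ) • (Zm 0 * Dm 0) + Zm 1 * Dm 1 - Zm 2 * Dm 2 - (N : ℂ) • 1

/-- `H₂ = 2z∂_z + y∂_y − x∂ₓ − M`. -/
noncomputable def H2 (M : ℕ) : Module.End ℂ P3 :=
  (2 : ℂ) • (Zm 2 * Dm 2) + Zm 1 * Dm 1 - Zm 0 * Dm 0 - (M : ℂ) • 1

/-- The span `V_{M,N}` of `{T₁₂ⁱ T₂₃ʲ T₁₃ᵏ (1) : i,j,k ∈ ℕ}` in `ℂ[x,y,z]`. -/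
noncomputable def Vmod (M N : ℕ) : Submodule ℂ P3 :=
  Submodule.span ℂ {q : P3 | ∃ i j k : ℕ, q = (T12 N ^ i * T23 M ^ j * T13 M N ^ k) (1 : P3)}

/-- The product `xᵃ yᵇ zᶜ wᵈ` with `w = xz + y`. -/
noncomputable def flagMonomial (a b c d : ℕ) : P3 :=
  X 0 ^ a * X 1 ^ b * X 2 ^ c * (X 0 * X 2 + X 1) ^ d

theorem flagMonomial_succ_succ (a b c d : ℕ) :
    flagMonomial (a + 1) b (c + 1) d =
      flagMonomial a b c (d + 1) - flagMonomial a (b + 1) c d := by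
  simp only [flagMonomial]; ring

theorem T21_flagMonomial (a b c d : ℕ) :
    T21 (flagMonomial a b c d) =
      (a : ℂ) • flagMonomial (a - 1) b c d + (d : ℂ) • flagMonomial a b (c + 1) (d - 1) := by
  rcases a with _ | a <;> rcases d with _ | d <;>
  simp [-mul_eq_mul_left_iff, -mul_eq_mul_right_iff, T21, Dm, flagMonomial,
    Derivation.leibniz, Derivation.leibniz_pow, pderiv_X, smul_eq_C_mul] <;> ring

theorem T31_flagMonomial (a b c d : ℕ) :
    T31 (flagMonomial a b c d) =
      (b : ℂ) • flagMonomial a (b - 1) c d + (d : ℂ) • flagMonomial a b c (d - 1) := by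
  rcases b with _ | b <;> rcases d with _ | d <;>
  simp [-mul_eq_mul_left_iff, -mul_eq_mul_right_iff, T31, Dm, flagMonomial,
    Derivation.leibniz, Derivation.leibniz_pow, pderiv_X, smul_eq_C_mul] <;> ring

theorem T32_flagMonomial (a b c d : ℕ) :
    T32 (flagMonomial a b c d) =
      (c : ℂ) • flagMonomial a b (c - 1) d - (b : ℂ) • flagMonomial (a + 1) (b - 1) c d := by
  rcases b with _ | b <;> rcases c with _ | c <;> rcases d with _ | d <;>
  simp [-mul_eq_mul_left_iff, -mul_eq_mul_right_iff, T32, Dm, Zm, flagMonomial,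
    Derivation.leibniz, Derivation.leibniz_pow, pderiv_X, smul_eq_C_mul] <;> ring

theorem T12_flagMonomial (N a b c d : ℕ) :
    T12 N (flagMonomial a b c d) =
      ((N : ℂ) - a - b) • flagMonomial (a + 1) b c d
        + (c : ℂ) • flagMonomial a b (c - 1) (d + 1) := by
  rcases a with _ | a <;> rcases b with _ | b <;> rcases c with _ | c <;> rcases d with _ | d <;>
  simp [-mul_eq_mul_left_iff, -mul_eq_mul_right_iff, T12, Dm, Zm, flagMonomial,
    Derivation.leibniz, Derivation.leibniz_pow, pderiv_X, smul_eq_C_mul] <;> ring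

theorem T23_flagMonomial (M a b c d : ℕ) :
    T23 M (flagMonomial a b c d) =
      ((M : ℂ) - c - d) • flagMonomial a b (c + 1) d
        - (a : ℂ) • flagMonomial (a - 1) (b + 1) c d := by
  rcases a with _ | a <;> rcases c with _ | c <;> rcases d with _ | d <;>
  simp [-mul_eq_mul_left_iff, -mul_eq_mul_right_iff, T23, Dm, Zm, flagMonomial,
    Derivation.leibniz, Derivation.leibniz_pow, pderiv_X, smul_eq_C_mul] <;> ring

theorem T13_flagMonomial (M N a b c d : ℕ) :
    T13 M N (flagMonomial a b c d) =
      ((N : ℂ) - a - b) • flagMonomial a (b + 1) c d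
        + ((M : ℂ) - c - d) • flagMonomial a b c (d + 1) := by
  rcases a with _ | a <;> rcases b with _ | b <;> rcases c with _ | c <;> rcases d with _ | d <;>
  simp [-mul_eq_mul_left_iff, -mul_eq_mul_right_iff, T13, Dm, Zm, flagMonomial,
    Derivation.leibniz, Derivation.leibniz_pow, pderiv_X, smul_eq_C_mul] <;> ring

theorem H1_flagMonomial (N a b c d : ℕ) :
    H1 N (flagMonomial a b c d) = (2 * a + b - c + d - N : ℂ) • flagMonomial a b c d := by
  rcases a with _ | a <;> rcases b with _ | b <;> rcases c with _ | c <;> rcases d with _ | d <;>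
  simp [-mul_eq_mul_left_iff, -mul_eq_mul_right_iff, map_ofNat C 2, H1, Dm, Zm, flagMonomial,
    Derivation.leibniz, Derivation.leibniz_pow, pderiv_X, smul_eq_C_mul] <;> ring

theorem H2_flagMonomial (M a b c d : ℕ) :
    H2 M (flagMonomial a b c d) = (2 * c + b - a + d - M : ℂ) • flagMonomial a b c d := by
  rcases a with _ | a <;> rcases b with _ | b <;> rcases c with _ | c <;> rcases d with _ | d <;>
  simp [-mul_eq_mul_left_iff, -mul_eq_mul_right_iff, map_ofNat C 2, H2, Dm, Zm, flagMonomial,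
    Derivation.leibniz, Derivation.leibniz_pow, pderiv_X, smul_eq_C_mul] <;> ring

theorem pderiv_pderiv_comm {R σ : Type*} [CommSemiring R] (i j : σ) (f : MvPolynomial σ R) :
    pderiv i (pderiv j f) = pderiv j (pderiv i f) := by
  classical
  induction f using MvPolynomial.induction_on with
  | C r => simp
  | add p q hp hq => simp [hp, hq]
  | mul_X p k hp =>
    simp only [pderiv_mul, map_add, hp, pderiv_X, Pi.single_apply]
    split_ifs <;> simp [add_comm, add_left_comm]

theorem Dm_apply (i : Fin 3) (f : P3) : Dm i f = pderiv i f := rfl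

theorem Zm_apply (i : Fin 3) (f : P3) : Zm i f = X i * f := rfl

theorem commute_T13_T12 (M N : ℕ) : Commute (T13 M N) (T12 N) := by
  refine LinearMap.ext fun f => ?_
  simp only [T13, T12, Dm_apply, Zm_apply, Module.End.mul_apply, LinearMap.add_apply,
    LinearMap.sub_apply, LinearMap.neg_apply, LinearMap.smul_apply, map_add, map_sub, map_neg,
    map_smul, Derivation.leibniz, smul_eq_mul,
    pderiv_X, pderiv_pderiv_comm 1 0 f, pderiv_pderiv_comm 2 0 f, pderiv_pderiv_comm 2 1 f]
  simp [smul_eq_C_mul]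
  ring

theorem commute_T13_T23 (M N : ℕ) : Commute (T13 M N) (T23 M) := by
  refine LinearMap.ext fun f => ?_
  simp only [T13, T23, Dm_apply, Zm_apply, Module.End.mul_apply, LinearMap.add_apply,
    LinearMap.sub_apply, LinearMap.neg_apply, LinearMap.smul_apply, map_add, map_sub, map_neg,
    map_smul, Derivation.leibniz, smul_eq_mul,
    pderiv_X, pderiv_pderiv_comm 1 0 f, pderiv_pderiv_comm 2 0 f, pderiv_pderiv_comm 2 1 f]
  simp [smul_eq_C_mul]
  ring

theorem T23_mul_T12 (M N : ℕ) : T23 M * T12 N = T12 N * T23 M - T13 M N := by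
  refine LinearMap.ext fun f => ?_
  simp only [T13, T12, T23, Dm_apply, Zm_apply, Module.End.mul_apply, LinearMap.add_apply,
    LinearMap.sub_apply, LinearMap.neg_apply, LinearMap.smul_apply, map_add, map_sub, map_neg,
    map_smul, Derivation.leibniz, smul_eq_mul,
    pderiv_X, pderiv_pderiv_comm 1 0 f, pderiv_pderiv_comm 2 0 f, pderiv_pderiv_comm 2 1 f]
  simp [smul_eq_C_mul]
  ring

theorem T12_mem_Vmod {M N : ℕ} {p : P3} (hp : p ∈ Vmod M N) : T12 N p ∈ Vmod M N := by
  induction hp using Submodule.span_induction with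
  | mem q hq =>
    obtain ⟨i, j, k, rfl⟩ := hq
    exact Submodule.subset_span ⟨i + 1, j, k, by simp only [pow_succ', Module.End.mul_apply]⟩
  | zero => simp
  | add p q _ _ hp hq => rw [map_add]; exact add_mem hp hq
  | smul c p _ hp => rw [map_smul]; exact Submodule.smul_mem _ c hp

theorem T13_mem_Vmod {M N : ℕ} {p : P3} (hp : p ∈ Vmod M N) : T13 M N p ∈ Vmod M N := by
  induction hp using Submodule.span_induction with
  | mem q hq =>
    obtain ⟨i, j, k, rfl⟩ := hq
    refine Submodule.subset_span ⟨i, j, k + 1, ?_⟩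
    have h : Commute (T13 M N) (T12 N ^ i * T23 M ^ j) :=
      ((commute_T13_T12 M N).pow_right i).mul_right ((commute_T13_T23 M N).pow_right j)
    rw [← Module.End.mul_apply, ← mul_assoc, h.eq, mul_assoc, ← pow_succ']
  | zero => simp
  | add p q _ _ hp hq => rw [map_add]; exact add_mem hp hq
  | smul c p _ hp => rw [map_smul]; exact Submodule.smul_mem _ c hp

theorem T23_mem_Vmod {M N : ℕ} {p : P3} (hp : p ∈ Vmod M N) : T23 M p ∈ Vmod M N := by
  induction hp using Submodule.span_induction with
  | mem q hq =>
    obtain ⟨i, j, k, rfl⟩ := hq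
    induction i with
    | zero =>
      exact Submodule.subset_span
        ⟨0, j + 1, k, by simp only [pow_zero, one_mul, pow_succ', Module.End.mul_apply]⟩
    | succ i ih =>
      have hmem : (T12 N ^ i * T23 M ^ j * T13 M N ^ k) 1 ∈ Vmod M N :=
        Submodule.subset_span ⟨i, j, k, rfl⟩
      have h : T23 M ((T12 N ^ (i + 1) * T23 M ^ j * T13 M N ^ k) 1) =
          T12 N (T23 M ((T12 N ^ i * T23 M ^ j * T13 M N ^ k) 1)) -
            T13 M N ((T12 N ^ i * T23 M ^ j * T13 M N ^ k) 1) := by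
        simpa only [pow_succ', Module.End.mul_apply, LinearMap.sub_apply] using
          LinearMap.congr_fun (T23_mul_T12 M N) ((T12 N ^ i * T23 M ^ j * T13 M N ^ k) 1)
      rw [h]
      exact sub_mem (T12_mem_Vmod ih) (T13_mem_Vmod hmem)
  | zero => simp
  | add p q _ _ hp hq => rw [map_add]; exact add_mem hp hq
  | smul c p _ hp => rw [map_smul]; exact Submodule.smul_mem _ c hp

/-- The span of the products `xᵃ yᵇ zᶜ wᵈ` with `a + b ≤ N` and `c + d ≤ M`. -/
noncomputable def flagSpan (M N : ℕ) : Submodule ℂ P3 :=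
  Submodule.span ℂ {q | ∃ a b c d : ℕ, a + b ≤ N ∧ c + d ≤ M ∧ q = flagMonomial a b c d}

theorem flagMonomial_mem_flagSpan {M N a b c d : ℕ} (hN : a + b ≤ N) (hM : c + d ≤ M) :
    flagMonomial a b c d ∈ flagSpan M N :=
  Submodule.subset_span ⟨a, b, c, d, hN, hM, rfl⟩

theorem smul_flagMonomial_mem_flagSpan {M N a b c d : ℕ} {r : ℂ}
    (h : r ≠ 0 → a + b ≤ N ∧ c + d ≤ M) : r • flagMonomial a b c d ∈ flagSpan M N := by
  rcases eq_or_ne r 0 with rfl | hr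
  · simp
  · exact Submodule.smul_mem _ _ (flagMonomial_mem_flagSpan (h hr).1 (h hr).2)

theorem map_mem_flagSpan {M N : ℕ} {T : Module.End ℂ P3}
    (hT : ∀ a b c d, a + b ≤ N → c + d ≤ M → T (flagMonomial a b c d) ∈ flagSpan M N)
    {p : P3} (hp : p ∈ flagSpan M N) : T p ∈ flagSpan M N := by
  suffices h : flagSpan M N ≤ (flagSpan M N).comap T from h hp
  refine Submodule.span_le.2 ?_
  rintro _ ⟨a, b, c, d, hN, hM, rfl⟩
  exact hT a b c d hN hM

theorem add_lt_of_cast_sub_sub_ne_zero {n a b : ℕ} (h : a + b ≤ n) (hne : (n : ℂ) - a - b ≠ 0) :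
    a + b < n := by
  refine lt_of_le_of_ne h ?_
  rintro rfl
  exact hne (by push_cast; ring)

theorem T21_mem_flagSpan {M N : ℕ} {p : P3} (hp : p ∈ flagSpan M N) :
    T21 p ∈ flagSpan M N := by
  refine map_mem_flagSpan (fun a b c d hN hM => ?_) hp
  rw [T21_flagMonomial]
  refine add_mem (smul_flagMonomial_mem_flagSpan fun h => ?_)
    (smul_flagMonomial_mem_flagSpan fun h => ?_) <;>
  · have := Nat.cast_ne_zero.1 h
    omega

theorem T31_mem_flagSpan {M N : ℕ} {p : P3} (hp : p ∈ flagSpan M N) :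
    T31 p ∈ flagSpan M N := by
  refine map_mem_flagSpan (fun a b c d hN hM => ?_) hp
  rw [T31_flagMonomial]
  refine add_mem (smul_flagMonomial_mem_flagSpan fun h => ?_)
    (smul_flagMonomial_mem_flagSpan fun h => ?_) <;>
  · have := Nat.cast_ne_zero.1 h
    omega

theorem T32_mem_flagSpan {M N : ℕ} {p : P3} (hp : p ∈ flagSpan M N) :
    T32 p ∈ flagSpan M N := by
  refine map_mem_flagSpan (fun a b c d hN hM => ?_) hp
  rw [T32_flagMonomial]
  refine sub_mem (smul_flagMonomial_mem_flagSpan fun h => ?_)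
    (smul_flagMonomial_mem_flagSpan fun h => ?_) <;>
  · have := Nat.cast_ne_zero.1 h
    omega

theorem T12_mem_flagSpan {M N : ℕ} {p : P3} (hp : p ∈ flagSpan M N) :
    T12 N p ∈ flagSpan M N := by
  refine map_mem_flagSpan (fun a b c d hN hM => ?_) hp
  rw [T12_flagMonomial]
  refine add_mem (smul_flagMonomial_mem_flagSpan fun h => ?_)
    (smul_flagMonomial_mem_flagSpan fun h => ?_)
  · have := add_lt_of_cast_sub_sub_ne_zero hN h
    omega
  · have := Nat.cast_ne_zero.1 h
    omega

theorem T23_mem_flagSpan {M N : ℕ} {p : P3} (hp : p ∈ flagSpan M N) :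
    T23 M p ∈ flagSpan M N := by
  refine map_mem_flagSpan (fun a b c d hN hM => ?_) hp
  rw [T23_flagMonomial]
  refine sub_mem (smul_flagMonomial_mem_flagSpan fun h => ?_)
    (smul_flagMonomial_mem_flagSpan fun h => ?_)
  · have := add_lt_of_cast_sub_sub_ne_zero hM h
    omega
  · have := Nat.cast_ne_zero.1 h
    omega

theorem T13_mem_flagSpan {M N : ℕ} {p : P3} (hp : p ∈ flagSpan M N) :
    T13 M N p ∈ flagSpan M N := by
  refine map_mem_flagSpan (fun a b c d hN hM => ?_) hp
  rw [T13_flagMonomial]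
  refine add_mem (smul_flagMonomial_mem_flagSpan fun h => ?_)
    (smul_flagMonomial_mem_flagSpan fun h => ?_)
  · have := add_lt_of_cast_sub_sub_ne_zero hN h
    omega
  · have := add_lt_of_cast_sub_sub_ne_zero hM h
    omega

theorem H1_mem_flagSpan {M N : ℕ} {p : P3} (hp : p ∈ flagSpan M N) :
    H1 N p ∈ flagSpan M N := by
  refine map_mem_flagSpan (fun a b c d hN hM => ?_) hp
  rw [H1_flagMonomial]
  exact smul_flagMonomial_mem_flagSpan fun _ => ⟨hN, hM⟩

theorem H2_mem_flagSpan {M N : ℕ} {p : P3} (hp : p ∈ flagSpan M N) :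
    H2 M p ∈ flagSpan M N := by
  refine map_mem_flagSpan (fun a b c d hN hM => ?_) hp
  rw [H2_flagMonomial]
  exact smul_flagMonomial_mem_flagSpan fun _ => ⟨hN, hM⟩

theorem one_eq_flagMonomial : (1 : P3) = flagMonomial 0 0 0 0 := by simp [flagMonomial]

theorem Vmod_le_flagSpan (M N : ℕ) : Vmod M N ≤ flagSpan M N := by
  have pow_mem {T : Module.End ℂ P3} (hT : ∀ p ∈ flagSpan M N, T p ∈ flagSpan M N) (n : ℕ) :
      ∀ p ∈ flagSpan M N, (T ^ n) p ∈ flagSpan M N := by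
    induction n with
    | zero => simp
    | succ n ih =>
      intro p hp
      rw [pow_succ', Module.End.mul_apply]
      exact hT _ (ih p hp)
  refine Submodule.span_le.2 ?_
  rintro _ ⟨i, j, k, rfl⟩
  rw [Module.End.mul_apply, Module.End.mul_apply, one_eq_flagMonomial]
  exact pow_mem (fun _ => T12_mem_flagSpan) i _ (pow_mem (fun _ => T23_mem_flagSpan) j _
    (pow_mem (fun _ => T13_mem_flagSpan) k _
      (flagMonomial_mem_flagSpan (Nat.zero_le N) (Nat.zero_le M))))

/-- The relation `xz = w - y` reduces every product to those not divisible by `xz`. -/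
theorem flagSpan_le {M N : ℕ} {S : Submodule ℂ P3}
    (h : ∀ a b c d, a + b ≤ N → c + d ≤ M → a = 0 ∨ c = 0 → flagMonomial a b c d ∈ S) :
    flagSpan M N ≤ S := by
  refine Submodule.span_le.2 ?_
  rintro _ ⟨a, b, c, d, hN, hM, rfl⟩
  induction a generalizing b c d with
  | zero => exact h _ _ _ _ hN hM (Or.inl rfl)
  | succ a ih =>
    rcases c with _ | c
    · exact h _ _ _ _ hN hM (Or.inr rfl)
    · rw [flagMonomial_succ_succ]
      exact sub_mem (ih b c (d + 1) (by omega) (by omega)) (ih (b + 1) c d (by omega) (by omega))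

theorem one_mem_Vmod (M N : ℕ) : (1 : P3) ∈ Vmod M N :=
  Submodule.subset_span ⟨0, 0, 0, by simp⟩

theorem mem_Vmod_of_add_smul_mem {M N : ℕ} {p q : P3} {r : ℂ} (hr : r ≠ 0)
    (h : r • p + q ∈ Vmod M N) (hq : q ∈ Vmod M N) : p ∈ Vmod M N :=
  ((Vmod M N).smul_mem_iff hr).1 (((Vmod M N).add_mem_iff_left hq).1 h)

theorem cast_sub_sub_ne_zero {n a b : ℕ} (h : a + b < n) : (n : ℂ) - a - b ≠ 0 := by
  rw [sub_sub, sub_ne_zero]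
  exact_mod_cast h.ne'

theorem flagMonomial_mem_Vmod_of_reduced {M N : ℕ} (a b c d : ℕ) (hN : a + b ≤ N) (hM : c + d ≤ M)
    (hac : a = 0 ∨ c = 0) : flagMonomial a b c d ∈ Vmod M N := by
  induction hh : a + 2 * b + c + 2 * d using Nat.strong_induction_on generalizing a b c d with
  | _ n ih =>
  subst hh
  rcases a with _ | a
  swap
  · obtain rfl : c = 0 := by omega
    have h := T12_mem_Vmod (ih _ (by omega) a b 0 d (by omega) hM (Or.inr rfl) rfl)
    rw [T12_flagMonomial] at h
    exact mem_Vmod_of_add_smul_mem (cast_sub_sub_ne_zero (by omega)) h (by simp)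
  rcases c with _ | c
  swap
  · have h := T23_mem_Vmod (ih _ (by omega) 0 b c d hN (by omega) (Or.inl rfl) rfl)
    rw [T23_flagMonomial, sub_eq_add_neg] at h
    exact mem_Vmod_of_add_smul_mem (cast_sub_sub_ne_zero (by omega)) h (by simp)
  have of_w (b' d' : ℕ) (hn : 2 * b' + 2 * (d' + 1) = 2 * b + 2 * d) (hN : b' ≤ N)
      (hM : d' + 1 ≤ M) : flagMonomial 0 b' 0 (d' + 1) ∈ Vmod M N := by
    have h₁ := T12_mem_Vmod (ih _ (by omega) 0 b' 1 d' (by omega) (by omega) (Or.inl rfl) rfl)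
    have h₂ := T13_mem_Vmod (ih _ (by omega) 0 b' 0 d' (by omega) (by omega) (Or.inl rfl) rfl)
    rw [T12_flagMonomial, flagMonomial_succ_succ] at h₁
    rw [T13_flagMonomial] at h₂
    have hne : ((N + M + 1 : ℕ) : ℂ) - b' - d' ≠ 0 := cast_sub_sub_ne_zero (by omega)
    refine ((Vmod M N).smul_mem_iff hne).1 ?_
    convert add_mem h₁ h₂ using 1
    simp only [Nat.sub_self]
    push_cast
    module
  rcases d with _ | d
  swap
  · exact of_w b d (by omega) (by omega) (by omega)
  rcases b with _ | b
  · exact one_eq_flagMonomial ▸ one_mem_Vmod M N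
  have h := T13_mem_Vmod (ih _ (by omega) 0 b 0 0 (by omega) (by omega) (Or.inl rfl) rfl)
  rw [T13_flagMonomial] at h
  refine mem_Vmod_of_add_smul_mem (cast_sub_sub_ne_zero (by omega)) h ?_
  rcases Nat.eq_zero_or_pos M with rfl | hpos
  · simp
  · exact Submodule.smul_mem _ _ (of_w b 0 (by omega) (by omega) (by omega))

theorem Vmod_eq_flagSpan (M N : ℕ) : Vmod M N = flagSpan M N :=
  le_antisymm (Vmod_le_flagSpan M N) (flagSpan_le flagMonomial_mem_Vmod_of_reduced)

theorem coeff_flagMonomial {a b c d : ℕ} {m : Fin 3 →₀ ℕ} (hm : m 1 ≤ b) :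
    coeff m (flagMonomial a b c d) =
      if m 0 = a + d ∧ m 1 = b ∧ m 2 = c + d then 1 else 0 := by
  induction d generalizing a b c with
  | zero =>
    have h : flagMonomial a b c 0 =
        monomial (Finsupp.single 0 a + Finsupp.single 1 b + Finsupp.single 2 c) 1 := by
      simp [flagMonomial, X_pow_eq_monomial, monomial_mul]
    rw [h, coeff_monomial]
    refine if_congr ?_ rfl rfl
    simp [Finsupp.ext_iff, Fin.forall_fin_succ, eq_comm]
  | succ d ih =>
    have h : flagMonomial a b c (d + 1) =
        flagMonomial (a + 1) b (c + 1) d + flagMonomial a (b + 1) c d := by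
      rw [flagMonomial_succ_succ, sub_add_cancel]
    rw [h, coeff_add, ih hm, ih (by omega), if_neg (by omega : ¬ (m 0 = a + d ∧ _)), add_zero]
    exact if_congr (by omega) rfl rfl

/-- The indices `(p, q, e)` of a basis of `flagSpan M N`, see `flagBasis`. -/
abbrev FlagIndex (M N : ℕ) : Type :=
  Σ pq : Fin (N + 1) × Fin (M + 1), Fin ((pq.1 : ℕ) + pq.2 + 1)

/-- The products `xᵃ yᵇ zᶜ wᵈ` with `a + b ≤ N`, `c + d ≤ M` and `ac = 0`. Here `b = N - p`,
`d = M - q`, and `e` encodes `(a, c)` through `a - c = e - q`. -/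
noncomputable def flagBasis (M N : ℕ) (i : FlagIndex M N) : P3 :=
  flagMonomial (i.2 - i.1.2) (N - i.1.1) (i.1.2 - i.2) (M - i.1.2)

theorem span_range_flagBasis (M N : ℕ) :
    Submodule.span ℂ (Set.range (flagBasis M N)) = flagSpan M N := by
  refine le_antisymm (Submodule.span_le.2 ?_) (flagSpan_le fun a b c d hN hM hac => ?_)
  · rintro _ ⟨⟨⟨p, q⟩, e⟩, rfl⟩
    have := p.2
    have := q.2
    have := e.2
    dsimp only at this
    exact flagMonomial_mem_flagSpan (by dsimp only; omega) (by dsimp only; omega)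
  · refine Submodule.subset_span
      ⟨⟨(⟨N - b, by omega⟩, ⟨M - d, by omega⟩), ⟨M - d + a - c, by dsimp only; omega⟩⟩, ?_⟩
    simp only [flagBasis]
    congr 1 <;> omega

theorem linearIndependent_flagBasis (M N : ℕ) : LinearIndependent ℂ (flagBasis M N) := by
  rw [Fintype.linearIndependent_iff]
  intro g hg
  by_contra! hne
  obtain ⟨i₀, hi₀⟩ := hne
  obtain ⟨i, hi, hmin⟩ := Finset.exists_min_image {i | g i ≠ 0}
    (fun i : FlagIndex M N => N - (i.1.1 : ℕ)) ⟨i₀, by simpa using hi₀⟩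
  simp only [Finset.mem_filter, Finset.mem_univ, true_and] at hi hmin
  let m : Fin 3 →₀ ℕ := Finsupp.equivFunOnFinite.symm
    ![(i.2 - i.1.2 : ℕ) + (M - i.1.2), N - i.1.1, (i.1.2 - i.2 : ℕ) + (M - i.1.2)]
  have hcoeff (j : FlagIndex M N) (hj : g j ≠ 0) :
      coeff m (flagBasis M N j) = if i = j then 1 else 0 := by
    rw [flagBasis, coeff_flagMonomial (by simpa [m] using hmin j hj)]
    refine if_congr ?_ rfl rfl
    constructor
    · obtain ⟨⟨⟨p, hp⟩, ⟨q, hq⟩⟩, ⟨e, he⟩⟩ := i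
      obtain ⟨⟨⟨p', hp'⟩, ⟨q', hq'⟩⟩, ⟨e', he'⟩⟩ := j
      intro h
      simp [m] at h
      dsimp only at he he'
      obtain rfl : p = p' := by omega
      obtain rfl : q = q' := by omega
      obtain rfl : e = e' := by omega
      rfl
    · rintro rfl
      simp [m]
  have h := congrArg (coeff m) hg
  rw [coeff_sum, Finset.sum_eq_single i] at h
  · rw [coeff_smul, hcoeff i hi] at h
    simp [hi] at h
  · intro j _ hji
    rcases eq_or_ne (g j) 0 with hj | hj
    · simp [hj]
    · simp [hcoeff j hj, hji.symm]
  · simp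

theorem two_mul_card_flagIndex (M N : ℕ) :
    2 * Fintype.card (FlagIndex M N) = (M + 1) * (N + 1) * (M + N + 2) := by
  have hsum (n : ℕ) : 2 * ∑ i : Fin (n + 1), (i : ℕ) = (n + 1) * n := by
    rw [Fin.sum_univ_eq_sum_range (fun i => i), mul_comm, Finset.sum_range_id_mul_two]
    rfl
  simp only [Fintype.card_sigma, Fintype.card_fin, Fintype.card_prod, Fintype.sum_prod_type,
    Finset.sum_add_distrib, Finset.sum_const, Finset.card_univ, smul_eq_mul, ← Finset.mul_sum,
    mul_add]
  linear_combination (M + 1) * hsum N + (N + 1) * hsum M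

/-- The span of `{T₁₂ⁱ T₂₃ʲ T₁₃ᵏ (1)}` is a finite-dimensional subspace of `ℂ[x,y,z]`
invariant under all generators `T₂₁, T₃₁, T₃₂, T₁₂, T₂₃, T₁₃, H₁, H₂`, of dimension
`(M+1)(N+1)(M+N+2)/2`. -/
theorem sl3_finite_dimensional_module (M N : ℕ) :
    Module.Finite ℂ (Vmod M N) ∧
    2 * Module.finrank ℂ (Vmod M N) = (M + 1) * (N + 1) * (M + N + 2) ∧
    (∀ p ∈ Vmod M N, T21 p ∈ Vmod M N) ∧
    (∀ p ∈ Vmod M N, T31 p ∈ Vmod M N) ∧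
    (∀ p ∈ Vmod M N, T32 p ∈ Vmod M N) ∧
    (∀ p ∈ Vmod M N, T12 N p ∈ Vmod M N) ∧
    (∀ p ∈ Vmod M N, T23 M p ∈ Vmod M N) ∧
    (∀ p ∈ Vmod M N, T13 M N p ∈ Vmod M N) ∧
    (∀ p ∈ Vmod M N, H1 N p ∈ Vmod M N) ∧
    (∀ p ∈ Vmod M N, H2 M p ∈ Vmod M N) := by
  have hfin : Module.Finite ℂ (Submodule.span ℂ (Set.range (flagBasis M N))) :=
    Module.Finite.span_of_finite ℂ (Set.finite_range _)
  have hrank := finrank_span_eq_card (linearIndependent_flagBasis M N)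
  rw [span_range_flagBasis] at hfin hrank
  rw [Vmod_eq_flagSpan, hrank, two_mul_card_flagIndex]
  exact ⟨hfin, rfl, fun _ => T21_mem_flagSpan, fun _ => T31_mem_flagSpan,
    fun _ => T32_mem_flagSpan, fun _ => T12_mem_flagSpan, fun _ => T23_mem_flagSpan,
    fun _ => T13_mem_flagSpan, fun _ => H1_mem_flagSpan, fun _ => H2_mem_flagSpan⟩
end
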